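/- arXiv:0710.5501 — 3 statements merged into one kernel-verified Lean document; each statement's English description precedes it below -/
import Mathlib

section
/- Let n be a positive natural number and let S = {−1, +1}^n (maps Fin n → ℝ taking values in {−1, +1}). Let f, g1, g2 : S → ℝ be strictly positive, C1, C2 ⊆ S with C^(a) := C1 ∩ C2 nonempty, and define the probability distributions P(s) ∝ f(s)g1(s)g2(s), P^(1)(s) ∝ f(s)g2(s)χ_{C1}(s), P^(2)(s) ∝ f(s)g1(s)χ_{C2}(s), P^(a)(s) ∝ f(s)χ_{C^(a)}(s), all normalized over S. Let U be a type and u : S → U an injective map (a globally maximal discriminator). Define the pushforward distributions P_U(v) = Σ_{s : u(s)=v} P(s) and similarly P^(l)_U, and define the discriminated distribution P^⊗(v) ∝ P^(1)_U(v)·P^(2)_U(v) / P_U(v) on the (finite) range of u, normalized to sum to 1. Moreover, for each coordinate i and x ∈ {−1,+1}, define P^(l)_{C_i}(x, v) = Σ_{s : s_i = x, u(s) = v} P^(l)(s), P_{C_i}(x, v) analogously from P, and the discriminated symbol probability P^⊗_{C_i}(x) ∝ Σ_{v : P_{C_i}(x,v) > 0} P^(1)_{C_i}(x,v)·P^(2)_{C_i}(x,v)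 / P_{C_i}(x,v), normalized over x ∈ {−1,+1}. Then P^⊗(u(s)) = P^(a)(s) for all s ∈ S, and P^⊗_{C_i}(x) = Σ_{s : s_i = x} P^(a)(s) for all i and x ∈ {−1,+1}; i.e., the discriminated distribution and the discriminated symbol probabilities are correct. -/
/-- If `u` is injective on `S`, summing over the elements of `S` that satisfy `p` and share the
`u`-value of `s` picks out the single term at `s`. -/
theorem Finset.sum_filter_and_eq_of_injOn {α U M : Type*} [DecidableEq U] [AddCommMonoid M]
    {S : Finset α} {u : α → U} (hu : Set.InjOn u ↑S) (p : α → Prop) [DecidablePred p]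
    (F : α → M) {s : α} (hs : s ∈ S) :
    ∑ t ∈ S.filter (fun t => p t ∧ u t = u s), F t = if p s then F s else 0 := by
  rw [Finset.sum_filter, Finset.sum_eq_single_of_mem s hs]
  · simp
  · intro t ht hts
    exact if_neg fun h => hts (hu ht hs h.2)

/-- If `u` is injective on `S`, summing over the elements of `S` that share the `u`-value of `s`
picks out the single term at `s`. -/
theorem Finset.sum_filter_eq_of_injOn {α U M : Type*} [DecidableEq U] [AddCommMonoid M]
    {S : Finset α} {u : α → U} (hu : Set.InjOn u ↑S) (F : α → M) {s : α} (hs : s ∈ S) :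
    ∑ t ∈ S.filter (fun t => u t = u s), F t = F s := by
  simpa using Finset.sum_filter_and_eq_of_injOn hu (fun _ => True) F hs

open Finset in
/-- For a globally maximal discriminator (an injective map `u`), the discriminated
distribution and the discriminated symbol probabilities are correct: they coincide with
the overall posterior of the dually coupled code. -/
theorem globally_maximal_discriminator_correct (n : ℕ) (hn : 0 < n)
    {U : Type*} [DecidableEq U]
    (f g1 g2 : (Fin n → ℝ) → ℝ)
    (Sfin : Finset (Fin n → ℝ))
    (hSfin : Sfin = Fintype.piFinset fun _ : Fin n => ({-1, 1} : Finset ℝ))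
    (hf : ∀ s ∈ Sfin, 0 < f s) (hg1 : ∀ s ∈ Sfin, 0 < g1 s) (hg2 : ∀ s ∈ Sfin, 0 < g2 s)
    (C1 C2 : Finset (Fin n → ℝ)) (hC1 : C1 ⊆ Sfin) (hC2 : C2 ⊆ Sfin)
    (hCa : (C1 ∩ C2).Nonempty)
    (u : (Fin n → ℝ) → U) (hu : Set.InjOn u ↑Sfin)
    (P P1 P2 Pa : (Fin n → ℝ) → ℝ)
    (hP : ∀ s, P s = (if s ∈ Sfin then f s * g1 s * g2 s else 0) /
      ∑ s' ∈ Sfin, f s' * g1 s' * g2 s')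
    (hP1 : ∀ s, P1 s = (if s ∈ C1 then f s * g2 s else 0) / ∑ s' ∈ C1, f s' * g2 s')
    (hP2 : ∀ s, P2 s = (if s ∈ C2 then f s * g1 s else 0) / ∑ s' ∈ C2, f s' * g1 s')
    (hPa : ∀ s, Pa s = (if s ∈ C1 ∩ C2 then f s else 0) / ∑ s' ∈ C1 ∩ C2, f s')
    (PU P1U P2U : U → ℝ)
    (hPU : ∀ v, PU v = ∑ s ∈ Sfin.filter (fun s => u s = v), P s)
    (hP1U : ∀ v, P1U v = ∑ s ∈ Sfin.filter (fun s => u s = v), P1 s)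
    (hP2U : ∀ v, P2U v = ∑ s ∈ Sfin.filter (fun s => u s = v), P2 s)
    (Pot : U → ℝ)
    (hPot : ∀ v, Pot v = (P1U v * P2U v / PU v) /
      ∑ v' ∈ Sfin.image u, P1U v' * P2U v' / PU v')
    (PC PC1 PC2 : Fin n → ℝ → U → ℝ)
    (hPC : ∀ i x v, PC i x v = ∑ s ∈ Sfin.filter (fun s => s i = x ∧ u s = v), P s)
    (hPC1 : ∀ i x v, PC1 i x v = ∑ s ∈ Sfin.filter (fun s => s i = x ∧ u s = v), P1 s)
    (hPC2 : ∀ i x v, PC2 i x v = ∑ s ∈ Sfin.filter (fun s => s i = x ∧ u s = v), P2 s)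
    (PotC : Fin n → ℝ → ℝ)
    (hPotC : ∀ i x, PotC i x =
      (∑ v ∈ (Sfin.image u).filter (fun v => 0 < PC i x v),
          PC1 i x v * PC2 i x v / PC i x v) /
      ∑ x' ∈ ({-1, 1} : Finset ℝ),
        ∑ v ∈ (Sfin.image u).filter (fun v => 0 < PC i x' v),
          PC1 i x' v * PC2 i x' v / PC i x' v) :
    (∀ s ∈ Sfin, Pot (u s) = Pa s) ∧
      ∀ i : Fin n, ∀ x ∈ ({-1, 1} : Finset ℝ),
        PotC i x = ∑ s ∈ Sfin.filter (fun s => s i = x), Pa s := by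
  have hne1 : C1.Nonempty := hCa.mono inter_subset_left
  have hne2 : C2.Nonempty := hCa.mono inter_subset_right
  have hneS : Sfin.Nonempty := hne1.mono hC1
  have hZ : 0 < ∑ s ∈ Sfin, f s * g1 s * g2 s :=
    sum_pos (fun s hs => mul_pos (mul_pos (hf s hs) (hg1 s hs)) (hg2 s hs)) hneS
  have hZ1 : 0 < ∑ s ∈ C1, f s * g2 s :=
    sum_pos (fun s hs => mul_pos (hf s (hC1 hs)) (hg2 s (hC1 hs))) hne1
  have hZ2 : 0 < ∑ s ∈ C2, f s * g1 s :=
    sum_pos (fun s hs => mul_pos (hf s (hC2 hs)) (hg1 s (hC2 hs))) hne2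
  have hCaS : C1 ∩ C2 ⊆ Sfin := inter_subset_left.trans hC1
  have hZa : 0 < ∑ s ∈ C1 ∩ C2, f s := sum_pos (fun s hs => hf s (hCaS hs)) hCa
  have hPa_sum : ∑ s ∈ Sfin, Pa s = 1 := by
    simp only [hPa]
    rw [← sum_div, sum_ite_mem, inter_eq_right.mpr hCaS, div_self hZa.ne']
  have hP_pos : ∀ s ∈ Sfin, 0 < P s := by
    intro s hs
    rw [hP, if_pos hs]
    exact div_pos (mul_pos (mul_pos (hf s hs) (hg1 s hs)) (hg2 s hs)) hZ
  obtain ⟨K, hK, hKP⟩ : ∃ K : ℝ, 0 < K ∧ ∀ s ∈ Sfin, P1 s * P2 s / P s = K * Pa s := by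
    refine ⟨(∑ s ∈ C1 ∩ C2, f s) * (∑ s ∈ Sfin, f s * g1 s * g2 s) /
      ((∑ s ∈ C1, f s * g2 s) * ∑ s ∈ C2, f s * g1 s), by positivity, fun s hs => ?_⟩
    have h0 := (hf s hs).ne'
    have h1 := (hg1 s hs).ne'
    have h2 := (hg2 s hs).ne'
    rw [hP, hP1, hP2, hPa, if_pos hs]
    by_cases hs1 : s ∈ C1
    · by_cases hs2 : s ∈ C2
      · rw [if_pos hs1, if_pos hs2, if_pos (mem_inter.mpr ⟨hs1, hs2⟩)]
        field_simp
      · simp [hs2]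
    · simp [hs1]
  have hword : ∀ s ∈ Sfin, P1U (u s) * P2U (u s) / PU (u s) = K * Pa s := by
    intro s hs
    rw [hP1U, hP2U, hPU, sum_filter_eq_of_injOn hu _ hs, sum_filter_eq_of_injOn hu _ hs,
      sum_filter_eq_of_injOn hu _ hs, hKP s hs]
  have hsymbol : ∀ i x, ∑ v ∈ (Sfin.image u).filter (fun v => 0 < PC i x v),
      PC1 i x v * PC2 i x v / PC i x v = K * ∑ s ∈ Sfin.filter (fun s => s i = x), Pa s := by
    intro i x
    rw [sum_filter, sum_image hu, mul_sum, sum_filter]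
    refine sum_congr rfl fun s hs => ?_
    rw [hPC, hPC1, hPC2, sum_filter_and_eq_of_injOn hu _ _ hs,
      sum_filter_and_eq_of_injOn hu _ _ hs, sum_filter_and_eq_of_injOn hu _ _ hs]
    by_cases hx : s i = x
    · simp only [if_pos hx, if_pos (hP_pos s hs), hKP s hs]
    · simp [hx]
  refine ⟨fun s hs => ?_, fun i x _ => ?_⟩
  · rw [hPot, sum_image hu, sum_congr rfl hword, hword s hs, ← mul_sum, hPa_sum, mul_one,
      mul_div_cancel_left₀ _ hK.ne']
  · have hcoord : ∀ s ∈ Sfin, s i ∈ ({-1, 1} : Finset ℝ) := by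
      intro s hs
      rw [hSfin] at hs
      exact Fintype.mem_piFinset.mp hs i
    rw [hPotC, sum_congr rfl fun x' _ => hsymbol i x', hsymbol, ← mul_sum,
      sum_fiberwise_of_maps_to hcoord, hPa_sum, mul_one, mul_div_cancel_left₀ _ hK.ne']
end

section
/- Define tanh₂(x) = (2^x − 2^{−x}) / (2^x + 2^{−x}) for x ∈ ℝ. Then for all real numbers v and L: v · tanh₂(v) ≤ v · tanh₂(L) if and only if ( |v| ≤ |L| and v · L ≥ 0 ). -/
/-- The base-two hyperbolic tangent is an order embedding of the reals. -/
lemma two_rpow_tanh_le_iff (x y : ℝ) :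
    ((2 : ℝ) ^ x - (2 : ℝ) ^ (-x)) / ((2 : ℝ) ^ x + (2 : ℝ) ^ (-x)) ≤
      ((2 : ℝ) ^ y - (2 : ℝ) ^ (-y)) / ((2 : ℝ) ^ y + (2 : ℝ) ^ (-y)) ↔ x ≤ y := by
  have hxy : (2 : ℝ) ^ (x - y) = (2 : ℝ) ^ x * (2 : ℝ) ^ (-y) := by
    rw [sub_eq_add_neg, Real.rpow_add two_pos]
  have hyx : (2 : ℝ) ^ (y - x) = (2 : ℝ) ^ y * (2 : ℝ) ^ (-x) := by
    rw [sub_eq_add_neg, Real.rpow_add two_pos]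
  have key : (2 : ℝ) ^ (x - y) ≤ (2 : ℝ) ^ (y - x) ↔ x - y ≤ y - x :=
    Real.rpow_le_rpow_left_iff one_lt_two
  rw [hxy, hyx] at key
  rw [div_le_div_iff₀ (by positivity) (by positivity)]
  constructor
  · intro h
    linarith [key.mp (by linarith)]
  · intro h
    linarith [key.mpr (by linarith)]

/-- The constraint `v·tanh₂(v) ≤ v·tanh₂(L)` is equivalent to `|v| ≤ |L|` together
with `v·L ≥ 0`. -/
theorem tanh2_constraint_iff (tanh2 : ℝ → ℝ)
    (htanh2 : ∀ x, tanh2 x =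
      ((2 : ℝ) ^ x - (2 : ℝ) ^ (-x)) / ((2 : ℝ) ^ x + (2 : ℝ) ^ (-x))) :
    ∀ v L : ℝ, v * tanh2 v ≤ v * tanh2 L ↔ (|v| ≤ |L| ∧ v * L ≥ 0) := by
  have tanh2_le_iff (x y : ℝ) : tanh2 x ≤ tanh2 y ↔ x ≤ y := by
    rw [htanh2, htanh2, two_rpow_tanh_le_iff]
  intro v L
  rcases lt_trichotomy v 0 with hv | rfl | hv
  · rw [mul_le_mul_left_of_neg hv, tanh2_le_iff, ge_iff_le, ← neg_mul_neg,
      mul_nonneg_iff_of_pos_left (neg_pos.mpr hv), neg_nonneg,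
      abs_of_neg hv]
    constructor
    · intro h
      rw [abs_of_neg (by linarith)]
      constructor <;> linarith
    · rintro ⟨h, hL⟩
      rw [abs_of_nonpos hL] at h
      linarith
  · simp
  · rw [mul_le_mul_iff_right₀ hv, tanh2_le_iff, ge_iff_le, mul_nonneg_iff_of_pos_left hv,
      abs_of_pos hv]
    constructor
    · intro h
      rw [abs_of_pos (by linarith)]
      constructor <;> linarith
    · rintro ⟨h, hL⟩
      rwa [abs_of_nonneg hL] at h
end

section
/- Let n be a positive natural number and let Q be a probability mass function on S = {−1,+1}^n with marginals q_i = Σ_{s : s_i = +1} Q(s) satisfying 0 < q_i < 1 for all i. Set w_i = (1/2) · log₂( q_i / (1 − q_i) ) and P(s|w) = Π_i 2^{s_i w_i} / (2^{w_i} + 2^{−w_i}). Then the Shannon entropy of the product distribution P(·|w) equals the cross entropy of Q relative to w: − Σ_{s ∈ S} P(s|w) · log₂ P(s|w) = − Σ_{s ∈ S} Q(s) · log₂ P(s|w). -/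
/-- The expectation of a function of one coordinate under a product of weights summing to one. -/
lemma sum_piFinset_prod_mul_eval {ι α R : Type*} [Fintype ι] [DecidableEq ι] [CommSemiring R]
    (t : ι → Finset α) (f : ι → α → R) (hf : ∀ j, ∑ x ∈ t j, f j x = 1) (i : ι) (g : α → R) :
    ∑ s ∈ Fintype.piFinset t, (∏ j, f j (s j)) * g (s i) = ∑ x ∈ t i, f i x * g x := by
  have h : ∀ s : ι → α, (∏ j, f j (s j)) * g (s i)
      = ∏ j, f j (s j) * (if j = i then g (s j) else 1) := fun s => by
    rw [Finset.prod_mul_distrib, Finset.prod_ite_eq' Finset.univ i]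
    simp
  simp_rw [h]
  rw [← Finset.prod_univ_sum t fun j x => f j x * (if j = i then g x else 1),
    Finset.prod_eq_single i]
  · simp
  · intro j _ hj
    simp [hj, hf]
  · simp

/-- The expectation of a separable affine function depends only on the coordinate means. -/
lemma sum_mul_sum_affine {ι R : Type*} [Fintype ι] [CommRing R] (S : Finset (ι → R))
    (p : (ι → R) → R) (hp : ∑ s ∈ S, p s = 1) (w c : ι → R) :
    ∑ s ∈ S, p s * ∑ i, (s i * w i - c i) = ∑ i, ((∑ s ∈ S, p s * s i) * w i - c i) := by
  simp_rw [Finset.mul_sum]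
  rw [Finset.sum_comm]
  refine Finset.sum_congr rfl fun i _ => ?_
  simp_rw [mul_sub, ← mul_assoc]
  rw [Finset.sum_sub_distrib, ← Finset.sum_mul, ← Finset.sum_mul, hp, one_mul]

/-- The mean of a sign-valued coordinate in terms of the weight of the value one. -/
lemma sum_mul_sign {ι : Type*} (S : Finset (ι → ℝ)) (p : (ι → ℝ) → ℝ)
    (hp : ∑ s ∈ S, p s = 1) (i : ι) (hS : ∀ s ∈ S, s i = -1 ∨ s i = 1) :
    ∑ s ∈ S, p s * s i = 2 * (∑ s ∈ S.filter (fun s => s i = 1), p s) - 1 := by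
  rw [Finset.sum_filter, Finset.mul_sum]
  refine Eq.trans ?_ (congrArg (_ - ·) hp)
  rw [← Finset.sum_sub_distrib]
  refine Finset.sum_congr rfl fun s hs => ?_
  rcases hS s hs with h | h
  · norm_num [h]
  · simp only [h, if_true]
    ring

lemma two_rpow_sub_div_add {q w : ℝ} (hq0 : 0 < q) (hq1 : q < 1)
    (hw : w = 1 / 2 * Real.logb 2 (q / (1 - q))) :
    ((2 : ℝ) ^ w - (2 : ℝ) ^ (-w)) / ((2 : ℝ) ^ w + (2 : ℝ) ^ (-w)) = 2 * q - 1 := by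
  have hq : 0 < 1 - q := sub_pos.2 hq1
  have ha : (0 : ℝ) < 2 ^ w := by positivity
  have hsq : (2 : ℝ) ^ w * 2 ^ w = q / (1 - q) := by
    rw [← Real.rpow_add two_pos, hw, ← add_mul, add_halves, one_mul,
      Real.rpow_logb two_pos (by norm_num) (div_pos hq0 hq)]
  rw [eq_div_iff hq.ne'] at hsq
  rw [Real.rpow_neg two_pos.le]
  field_simp
  linear_combination 2 * hsq

lemma logb_prod_two_rpow_div {ι : Type*} [Fintype ι] (a z : ι → ℝ) (hz : ∀ i, z i ≠ 0) :
    Real.logb 2 (∏ i, (2 : ℝ) ^ a i / z i) = ∑ i, (a i - Real.logb 2 (z i)) := by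
  rw [Real.logb_prod]
  · refine Finset.sum_congr rfl fun i _ => ?_
    rw [Real.logb_div (by positivity) (hz i), Real.logb_rpow two_pos (by norm_num)]
  · exact fun i _ => div_ne_zero (by positivity) (hz i)

open Finset in
/-- Choosing the transfer vector by the logarithmic symbol probability ratios of `Q`
makes the entropy of the product distribution equal to the cross entropy of `Q`. -/
theorem entropy_eq_cross_entropy_of_matching_ratios (n : ℕ) (hn : 0 < n)
    (Sfin : Finset (Fin n → ℝ))
    (hSfin : Sfin = Fintype.piFinset fun _ : Fin n => ({-1, 1} : Finset ℝ))
    (Q : (Fin n → ℝ) → ℝ)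
    (hQ0 : ∀ s ∈ Sfin, 0 ≤ Q s) (hQ1 : ∑ s ∈ Sfin, Q s = 1)
    (q : Fin n → ℝ)
    (hq : ∀ i, q i = ∑ s ∈ Sfin.filter (fun s => s i = 1), Q s)
    (hq0 : ∀ i, 0 < q i) (hq1 : ∀ i, q i < 1)
    (w : Fin n → ℝ)
    (hw : ∀ i, w i = (1 / 2) * Real.logb 2 (q i / (1 - q i)))
    (Pw : (Fin n → ℝ) → ℝ)
    (hPw : ∀ s, Pw s = ∏ i, (2 : ℝ) ^ (s i * w i) / ((2 : ℝ) ^ (w i) + (2 : ℝ) ^ (-w i))) :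
    -∑ s ∈ Sfin, Pw s * Real.logb 2 (Pw s) = -∑ s ∈ Sfin, Q s * Real.logb 2 (Pw s) := by
  have hZ : ∀ i, (2 : ℝ) ^ w i + (2 : ℝ) ^ (-w i) ≠ 0 := fun i => by positivity
  have hlog : ∀ s, Real.logb 2 (Pw s)
      = ∑ i, (s i * w i - Real.logb 2 ((2 : ℝ) ^ w i + (2 : ℝ) ^ (-w i))) := fun s => by
    rw [hPw s, logb_prod_two_rpow_div (fun i => s i * w i) _ hZ]
  have hf : ∀ i, ∑ x ∈ ({-1, 1} : Finset ℝ),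
      (2 : ℝ) ^ (x * w i) / ((2 : ℝ) ^ w i + (2 : ℝ) ^ (-w i)) = 1 := fun i => by
    rw [sum_pair (by norm_num), ← add_div, neg_one_mul, one_mul, add_comm, div_self (hZ i)]
  have hP1 : ∑ s ∈ Sfin, Pw s = 1 := by
    simp_rw [hSfin, hPw]
    rw [← prod_univ_sum (fun _ => ({-1, 1} : Finset ℝ)) fun i x =>
      (2 : ℝ) ^ (x * w i) / ((2 : ℝ) ^ w i + (2 : ℝ) ^ (-w i))]
    exact prod_eq_one fun i _ => hf i
  have hPmean : ∀ i, ∑ s ∈ Sfin, Pw s * s i = 2 * q i - 1 := fun i => by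
    simp_rw [hSfin, hPw]
    rw [sum_piFinset_prod_mul_eval _ (fun i x =>
      (2 : ℝ) ^ (x * w i) / ((2 : ℝ) ^ w i + (2 : ℝ) ^ (-w i))) hf i fun x => x,
      sum_pair (by norm_num), ← two_rpow_sub_div_add (hq0 i) (hq1 i) (hw i), neg_one_mul, one_mul]
    ring
  have hQmean : ∀ i, ∑ s ∈ Sfin, Q s * s i = 2 * q i - 1 := fun i => by
    rw [hq i]
    refine sum_mul_sign Sfin Q hQ1 i fun s hs => ?_
    rw [hSfin, Fintype.mem_piFinset] at hs
    simpa using hs i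
  simp_rw [hlog]
  rw [sum_mul_sum_affine Sfin Pw hP1, sum_mul_sum_affine Sfin Q hQ1]
  simp_rw [hPmean, hQmean]
end
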